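/- u∘S = u if and only if α_a = α⁻¹; that is, σ(h₁ ⊗ S(h₂)) = σ(h₂ ⊗ S(h₁)) for all h ∈ H if and only if σ(h ⊗ a⁻¹) = α(S(h)) for all h ∈ H. -/

import Mathlib

open TensorProduct Coalgebra HopfAlgebra

variable {k H : Type*} [Field k] [Ring H] [HopfAlgebra k H]

/-- The antipode of `H`, as a linear map. -/
local notation "𝐒" => HopfAlgebra.antipode (R := k)

/-- Convolution product on the dual of `H`: `(conv f g) h = f h₁ * g h₂`. -/
noncomputable def conv (f g : H →ₗ[k] k) : H →ₗ[k] k :=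
  (LinearMap.mul' k k) ∘ₗ (TensorProduct.map f g) ∘ₗ (Coalgebra.comul (R := k))

/-- `h ↦ f h₁ • h₂`. -/
noncomputable def lT (f : H →ₗ[k] k) : H →ₗ[k] H :=
  (TensorProduct.lid k H).toLinearMap ∘ₗ (f.rTensor H) ∘ₗ (Coalgebra.comul (R := k))

/-- The Sweedler sum `h ↦ f h₁ • p h₃ • g h₂`. -/
noncomputable def sw3 (f : H →ₗ[k] k) (g : H →ₗ[k] H) (p : H →ₗ[k] k) : H →ₗ[k] H :=
  (TensorProduct.lid k H).toLinearMap
    ∘ₗ (TensorProduct.rid k (k ⊗[k] H)).toLinearMap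
    ∘ₗ (TensorProduct.map (TensorProduct.map f g) p)
    ∘ₗ ((Coalgebra.comul (R := k)).rTensor H)
    ∘ₗ (Coalgebra.comul (R := k))

/-- `χ(h) = α(h₂) • S⁻²(h₁)`, the generalized Nakayama automorphism. -/
noncomputable def chiMap (Sinv : H →ₗ[k] H) (f : H →ₗ[k] k) : H →ₗ[k] H :=
  (TensorProduct.rid k H).toLinearMap
    ∘ₗ (TensorProduct.map (Sinv ∘ₗ Sinv) f)
    ∘ₗ (Coalgebra.comul (R := k))

/-- `f(R¹) • R²` for `R = R¹ ⊗ R² ∈ H ⊗ H`. -/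
noncomputable def lap (f : H →ₗ[k] k) : (H ⊗[k] H) →ₗ[k] H :=
  (TensorProduct.lid k H).toLinearMap ∘ₗ (f.rTensor H)

/-- `f(R²) • R¹` for `R = R¹ ⊗ R² ∈ H ⊗ H`. -/
noncomputable def rap (f : H →ₗ[k] k) : (H ⊗[k] H) →ₗ[k] H :=
  (TensorProduct.rid k H).toLinearMap ∘ₗ (LinearMap.lTensor H f)

/-- The Drinfeld element `u = S(R²)R¹`. -/
noncomputable def uElt (Rm : H ⊗[k] H) : H :=
  (LinearMap.mul' k H)
    ((TensorProduct.comm k H H)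
      ((LinearMap.lTensor H (HopfAlgebra.antipode (R := k))) Rm))

/-- Convolution product on the dual of `H ⊗ H`. -/
noncomputable def conv2 (f g : (H ⊗[k] H) →ₗ[k] k) : (H ⊗[k] H) →ₗ[k] k :=
  (LinearMap.mul' k k) ∘ₗ (TensorProduct.map f g) ∘ₗ (Coalgebra.comul (R := k) (A := H ⊗[k] H))

/-- `(h ⊗ l) ↦ σ(h₂ ⊗ l₂) • (l₁ * h₁)`. -/
noncomputable def ac1 (σ : (H ⊗[k] H) →ₗ[k] k) : (H ⊗[k] H) →ₗ[k] H :=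
  (TensorProduct.rid k H).toLinearMap
    ∘ₗ (TensorProduct.map ((LinearMap.mul' k H) ∘ₗ (TensorProduct.comm k H H).toLinearMap) σ)
    ∘ₗ (TensorProduct.tensorTensorTensorComm k H H H H).toLinearMap
    ∘ₗ (TensorProduct.map (Coalgebra.comul (R := k)) (Coalgebra.comul (R := k)))

/-- `(h ⊗ l) ↦ σ(h₁ ⊗ l₁) • (h₂ * l₂)`. -/
noncomputable def ac2 (σ : (H ⊗[k] H) →ₗ[k] k) : (H ⊗[k] H) →ₗ[k] H :=
  (TensorProduct.lid k H).toLinearMap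
    ∘ₗ (TensorProduct.map σ (LinearMap.mul' k H))
    ∘ₗ (TensorProduct.tensorTensorTensorComm k H H H H).toLinearMap
    ∘ₗ (TensorProduct.map (Coalgebra.comul (R := k)) (Coalgebra.comul (R := k)))

/-- `(h ⊗ l) ↦ ρ(h₁ ⊗ l₁) * lam(h₂ * l₂) * τ(h₃ ⊗ l₃)`. -/
noncomputable def trip (lam : H →ₗ[k] k) (ρ τ : (H ⊗[k] H) →ₗ[k] k) : (H ⊗[k] H) →ₗ[k] k :=
  (LinearMap.mul' k k)
    ∘ₗ ((LinearMap.mul' k k).rTensor k)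
    ∘ₗ (TensorProduct.map (TensorProduct.map ρ (lam ∘ₗ (LinearMap.mul' k H))) τ)
    ∘ₗ ((TensorProduct.tensorTensorTensorComm k H H H H).toLinearMap.rTensor (H ⊗[k] H))
    ∘ₗ (TensorProduct.tensorTensorTensorComm k (H ⊗[k] H) H (H ⊗[k] H) H).toLinearMap
    ∘ₗ (TensorProduct.map
          (((Coalgebra.comul (R := k)).rTensor H) ∘ₗ (Coalgebra.comul (R := k)))
          (((Coalgebra.comul (R := k)).rTensor H) ∘ₗ (Coalgebra.comul (R := k))))

/-- `u(h) = σ(h₂ ⊗ S h₁)`. -/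
noncomputable def uF (σ : (H ⊗[k] H) →ₗ[k] k) : H →ₗ[k] k :=
  σ ∘ₗ (TensorProduct.comm k H H).toLinearMap
    ∘ₗ ((HopfAlgebra.antipode (R := k)).rTensor H) ∘ₗ (Coalgebra.comul (R := k))

/-- `v(h) = σ(h₁ ⊗ S h₂)`. -/
noncomputable def vF (σ : (H ⊗[k] H) →ₗ[k] k) : H →ₗ[k] k :=
  σ ∘ₗ (LinearMap.lTensor H (HopfAlgebra.antipode (R := k))) ∘ₗ (Coalgebra.comul (R := k))

/-- `u⁻¹(h) = σ(S²(h₂) ⊗ h₁)`. -/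
noncomputable def uinvF (σ : (H ⊗[k] H) →ₗ[k] k) : H →ₗ[k] k :=
  σ ∘ₗ (((HopfAlgebra.antipode (R := k)) ∘ₗ (HopfAlgebra.antipode (R := k))).rTensor H)
    ∘ₗ (TensorProduct.comm k H H).toLinearMap ∘ₗ (Coalgebra.comul (R := k))

/-- `v⁻¹(h) = σ(S²(h₁) ⊗ h₂)`. -/
noncomputable def vinvF (σ : (H ⊗[k] H) →ₗ[k] k) : H →ₗ[k] k :=
  σ ∘ₗ (((HopfAlgebra.antipode (R := k)) ∘ₗ (HopfAlgebra.antipode (R := k))).rTensor H)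
    ∘ₗ (Coalgebra.comul (R := k))

section Convolution

/-- `h ↦ f h₂ • h₁`. -/
noncomputable def rT (f : H →ₗ[k] k) : H →ₗ[k] H :=
  (TensorProduct.rid k H).toLinearMap ∘ₗ (f.lTensor H) ∘ₗ (Coalgebra.comul (R := k))

/-- `h ↦ φ h₁ h₂` for `φ` with values in the dual space. -/
noncomputable def diag (φ : H →ₗ[k] H →ₗ[k] k) : H →ₗ[k] k :=
  TensorProduct.lift φ ∘ₗ (Coalgebra.comul (R := k))

/-- Left convolution by `f`, as a linear map on the dual space. -/
noncomputable def convLeft (f : H →ₗ[k] k) : (H →ₗ[k] k) →ₗ[k] H →ₗ[k] k where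
  toFun g := conv f g
  map_add' g g' := by simp [conv, TensorProduct.map_add_right, LinearMap.add_comp,
    LinearMap.comp_add]
  map_smul' c g := by simp [conv, TensorProduct.map_smul_right, LinearMap.smul_comp,
    LinearMap.comp_smul]

/-- Right convolution by `g`, as a linear map on the dual space. -/
noncomputable def convRight (g : H →ₗ[k] k) : (H →ₗ[k] k) →ₗ[k] H →ₗ[k] k where
  toFun f := conv f g
  map_add' f f' := by simp [conv, TensorProduct.map_add_left, LinearMap.add_comp,
    LinearMap.comp_add]
  map_smul' c f := by simp [conv, TensorProduct.map_smul_left, LinearMap.smul_comp,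
    LinearMap.comp_smul]

@[simp] lemma convLeft_apply (f g : H →ₗ[k] k) : convLeft f g = conv f g := rfl

@[simp] lemma convRight_apply (f g : H →ₗ[k] k) : convRight g f = conv f g := rfl

lemma comul_assoc_ext {M : Type*} [AddCommGroup M] [Module k M]
    (F : (H ⊗[k] H) ⊗[k] H →ₗ[k] M) (F₁ F₂ : H ⊗[k] H →ₗ[k] M)
    (h₁ : ∀ x y : H, F (Coalgebra.comul x ⊗ₜ y) = F₁ (x ⊗ₜ y))
    (h₂ : ∀ x y : H,
      F ((TensorProduct.assoc k H H H).symm (x ⊗ₜ Coalgebra.comul y)) = F₂ (x ⊗ₜ y))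
    (h : H) : F₁ (Coalgebra.comul h) = F₂ (Coalgebra.comul h) := by
  have e₁ : F₁ = F ∘ₗ (Coalgebra.comul (R := k)).rTensor H := by
    ext x y; simp [h₁]
  have e₂ : F₂ = F ∘ₗ (TensorProduct.assoc k H H H).symm.toLinearMap ∘ₗ
      (Coalgebra.comul (R := k)).lTensor H := by
    ext x y; simp [h₂]
  rw [e₁, e₂]
  simp

lemma conv_eq_apply_rT (f g : H →ₗ[k] k) (h : H) : conv f g h = f (rT g h) := by
  simp only [conv, rT, LinearMap.comp_apply]
  induction (Coalgebra.comul (R := k) h) with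
  | zero => simp
  | tmul x y => simp [mul_comm]
  | add s t hs ht => simp_all

lemma conv_eq_apply_lT (f g : H →ₗ[k] k) (h : H) : conv f g h = g (lT f h) := by
  simp only [conv, lT, LinearMap.comp_apply]
  induction (Coalgebra.comul (R := k) h) with
  | zero => simp
  | tmul x y => simp
  | add s t hs ht => simp_all

lemma lT_rT (f g : H →ₗ[k] k) (h : H) : lT f (rT g h) = rT g (lT f h) := by
  have := comul_assoc_ext
    ((TensorProduct.rid k H).toLinearMap ∘ₗ
      TensorProduct.map ((TensorProduct.lid k H).toLinearMap ∘ₗ f.rTensor H) g)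
    (lT f ∘ₗ (TensorProduct.rid k H).toLinearMap ∘ₗ g.lTensor H)
    (rT g ∘ₗ (TensorProduct.lid k H).toLinearMap ∘ₗ f.rTensor H)
    (fun x y ↦ by simp [lT])
    (fun x y ↦ by
      simp only [rT, LinearMap.comp_apply, LinearMap.rTensor_tmul, LinearEquiv.coe_coe,
        TensorProduct.lid_tmul, map_smul]
      induction (Coalgebra.comul (R := k) y) with
      | zero => simp
      | tmul x y => simp [smul_smul, mul_comm]
      | add s t hs ht => simp_all [TensorProduct.tmul_add]) h
  simpa [lT, rT] using this

lemma rT_rT (f g : H →ₗ[k] k) (h : H) : rT f (rT g h) = rT (conv f g) h := by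
  have := comul_assoc_ext
    ((TensorProduct.rid k H).toLinearMap ∘ₗ
      TensorProduct.map ((TensorProduct.rid k H).toLinearMap ∘ₗ f.lTensor H) g)
    (rT f ∘ₗ (TensorProduct.rid k H).toLinearMap ∘ₗ g.lTensor H)
    ((TensorProduct.rid k H).toLinearMap ∘ₗ (conv f g).lTensor H)
    (fun x y ↦ by simp [rT])
    (fun x y ↦ by
      simp only [conv, LinearMap.comp_apply, LinearMap.lTensor_tmul, LinearEquiv.coe_coe,
        TensorProduct.rid_tmul]
      induction (Coalgebra.comul (R := k) y) with
      | zero => simp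
      | tmul x y => simp [smul_smul, mul_comm]
      | add s t hs ht => simp_all [TensorProduct.tmul_add, add_smul]) h
  simpa [rT] using this

lemma conv_assoc (f g l : H →ₗ[k] k) : conv (conv f g) l = conv f (conv g l) := by
  ext h
  simp [conv_eq_apply_rT, rT_rT]

lemma lT_lT (f g : H →ₗ[k] k) (h : H) : lT f (lT g h) = lT (conv g f) h := by
  refine (Module.forall_dual_apply_eq_zero_iff k _).1 (fun φ ↦ ?_) |> sub_eq_zero.1
  rw [map_sub, ← conv_eq_apply_lT, ← conv_eq_apply_lT, ← conv_eq_apply_lT, conv_assoc, sub_self]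

lemma lT_counit (h : H) : lT (Coalgebra.counit (R := k)) h = h := by
  simp [lT]

lemma rT_counit (h : H) : rT (Coalgebra.counit (R := k)) h = h := by
  simp [rT]

lemma counit_conv (f : H →ₗ[k] k) : conv Coalgebra.counit f = f := by
  ext h; rw [conv_eq_apply_lT, lT_counit]

lemma conv_counit (f : H →ₗ[k] k) : conv f Coalgebra.counit = f := by
  ext h; rw [conv_eq_apply_rT, rT_counit]

lemma counit_lT (f : H →ₗ[k] k) (h : H) : Coalgebra.counit (R := k) (lT f h) = f h := by
  rw [← conv_eq_apply_lT, conv_counit]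

lemma counit_rT (f : H →ₗ[k] k) (h : H) : Coalgebra.counit (R := k) (rT f h) = f h := by
  rw [← conv_eq_apply_rT, counit_conv]

lemma sw3_id (f g : H →ₗ[k] k) (h : H) : sw3 f LinearMap.id g h = lT f (rT g h) := by
  simp only [sw3, rT, LinearMap.comp_apply]
  induction (Coalgebra.comul (R := k) h) with
  | zero => simp
  | tmul x y =>
    simp only [lT, LinearMap.comp_apply, LinearMap.lTensor_tmul, LinearMap.rTensor_tmul,
      LinearEquiv.coe_coe, TensorProduct.map_tmul, TensorProduct.rid_tmul, map_smul]
    rfl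
  | add s t hs ht => simp_all

lemma diag_comp_rT (φ : H →ₗ[k] H →ₗ[k] k) (f : H →ₗ[k] k) :
    diag (φ ∘ₗ rT f) = diag (convLeft f ∘ₗ φ) := by
  ext h
  refine comul_assoc_ext
    (TensorProduct.lift φ ∘ₗ
      ((TensorProduct.rid k H).toLinearMap ∘ₗ f.lTensor H).rTensor H)
    (TensorProduct.lift (φ ∘ₗ rT f)) (TensorProduct.lift (convLeft f ∘ₗ φ))
    (fun x y ↦ by simp [rT]) (fun x y ↦ ?_) h
  simp only [conv, LinearMap.comp_apply, TensorProduct.lift.tmul, convLeft_apply]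
  induction (Coalgebra.comul (R := k) y) with
  | zero => simp
  | tmul x y => simp
  | add s t hs ht => simp_all [TensorProduct.tmul_add]

lemma diag_comp_lT (φ : H →ₗ[k] H →ₗ[k] k) (f : H →ₗ[k] k) :
    diag (φ ∘ₗ lT f) = conv f (diag φ) := by
  ext h
  refine comul_assoc_ext
    (TensorProduct.lift φ ∘ₗ
      ((TensorProduct.lid k H).toLinearMap ∘ₗ f.rTensor H).rTensor H)
    (TensorProduct.lift (φ ∘ₗ lT f)) (LinearMap.mul' k k ∘ₗ TensorProduct.map f (diag φ))
    (fun x y ↦ by simp [lT]) (fun x y ↦ ?_) h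
  simp only [diag, LinearMap.comp_apply, TensorProduct.map_tmul]
  induction (Coalgebra.comul (R := k) y) with
  | zero => simp
  | tmul x y => simp
  | add s t hs ht => simp_all [TensorProduct.tmul_add]

lemma conv_diag (φ : H →ₗ[k] H →ₗ[k] k) (g : H →ₗ[k] k) :
    conv (diag φ) g = diag (convRight g ∘ₗ φ) := by
  ext h
  refine comul_assoc_ext
    (LinearMap.mul' k k ∘ₗ TensorProduct.map (TensorProduct.lift φ) g)
    (LinearMap.mul' k k ∘ₗ TensorProduct.map (diag φ) g)
    (TensorProduct.lift (convRight g ∘ₗ φ))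
    (fun x y ↦ by simp [diag]) (fun x y ↦ ?_) h
  simp only [conv, LinearMap.comp_apply, TensorProduct.lift.tmul, convRight_apply]
  induction (Coalgebra.comul (R := k) y) with
  | zero => simp
  | tmul x y => simp
  | add s t hs ht => simp_all [TensorProduct.tmul_add]

end Convolution

section Integral

variable {lam : H →ₗ[k] k} {a : H} {Sinv : H →ₗ[k] H}

lemma mul_lTensor_antipodeInv_comul (hSinv_l : ∀ h : H, Sinv (𝐒 h) = h)
    (hSinv_r : ∀ h : H, 𝐒 (Sinv h) = h) (h : H) :
    LinearMap.mul' k H (TensorProduct.comm k H H (Sinv.lTensor H (Coalgebra.comul h))) =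
      algebraMap k H (Coalgebra.counit h) := by
  refine Function.LeftInverse.injective hSinv_l ?_
  have key : 𝐒 ∘ₗ LinearMap.mul' k H ∘ₗ (TensorProduct.comm k H H).toLinearMap ∘ₗ
      Sinv.lTensor H = LinearMap.mul' k H ∘ₗ (HopfAlgebra.antipode k).rTensor H := by
    ext x y; simp [HopfAlgebra.antipode_mul_antidistrib, hSinv_r]
  have := DFunLike.congr_fun key (Coalgebra.comul h)
  simpa [Algebra.algebraMap_eq_smul_one] using this

lemma mul_rTensor_antipodeInv_comul (hSinv_l : ∀ h : H, Sinv (𝐒 h) = h)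
    (hSinv_r : ∀ h : H, 𝐒 (Sinv h) = h) (h : H) :
    LinearMap.mul' k H (TensorProduct.comm k H H (Sinv.rTensor H (Coalgebra.comul h))) =
      algebraMap k H (Coalgebra.counit h) := by
  refine Function.LeftInverse.injective hSinv_l ?_
  have key : 𝐒 ∘ₗ LinearMap.mul' k H ∘ₗ (TensorProduct.comm k H H).toLinearMap ∘ₗ
      Sinv.rTensor H = LinearMap.mul' k H ∘ₗ (HopfAlgebra.antipode k).lTensor H := by
    ext x y; simp [HopfAlgebra.antipode_mul_antidistrib, hSinv_r]
  have := DFunLike.congr_fun key (Coalgebra.comul h)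
  simpa [Algebra.algebraMap_eq_smul_one] using this

/-- `λ(x l₁) f(l₂) = λ(x₁ l) f(S⁻¹(x₂) a⁻¹)`. -/
lemma integral_mul_rT (hSinv_l : ∀ h : H, Sinv (𝐒 h) = h) (hSinv_r : ∀ h : H, 𝐒 (Sinv h) = h)
    (ha_mod : ∀ h : H, lT lam h = lam h • (𝐒 a)) (f : H →ₗ[k] k) (x l : H) :
    lam (x * rT f l) = lam (rT (f ∘ₗ LinearMap.mulRight k (𝐒 a) ∘ₗ Sinv) x * l) := by
  let F (t : H ⊗[k] H) : (H ⊗[k] H) ⊗[k] H →ₗ[k] k :=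
    f ∘ₗ LinearMap.mul' k H ∘ₗ (TensorProduct.comm k H H).toLinearMap ∘ₗ
      TensorProduct.map
        ((TensorProduct.lid k H).toLinearMap ∘ₗ lam.rTensor H ∘ₗ LinearMap.mulRight k t) Sinv
  have key : ∀ t : H ⊗[k] H, F t ((Coalgebra.comul (R := k)).rTensor H (Coalgebra.comul x)) =
      LinearMap.mul' k k (TensorProduct.map (lam ∘ₗ LinearMap.mulLeft k x) f t) := by
    intro t
    induction t with
    | zero => simp [F]
    | add s t hs ht =>
      rw [map_add, map_add, ← hs, ← ht, ← LinearMap.add_apply]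
      congr 1
      ext
      simp [F, mul_add]
    | tmul y z =>
      refine (comul_assoc_ext (F (y ⊗ₜ z))
        (F (y ⊗ₜ z) ∘ₗ (Coalgebra.comul (R := k)).rTensor H)
        (LinearMap.mul' k k ∘ₗ
          TensorProduct.map (lam ∘ₗ LinearMap.mulRight k y) (f z • Coalgebra.counit))
        (fun u w ↦ by simp) (fun u w ↦ ?_) x).trans ?_
      · have e : ∀ t : H ⊗[k] H, F (y ⊗ₜ z) ((TensorProduct.assoc k H H H).symm (u ⊗ₜ t)) =
            lam (u * y) * f (LinearMap.mul' k H (TensorProduct.comm k H H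
              (Sinv.lTensor H t)) * z) := by
          intro t
          induction t with
          | zero => simp
          | tmul v w => simp [F, mul_assoc]
          | add s t hs ht => simp_all [TensorProduct.tmul_add, add_mul, mul_add]
        rw [e, mul_lTensor_antipodeInv_comul hSinv_l hSinv_r, ← Algebra.smul_def]
        simp [mul_comm]
      · have e : ∀ t : H ⊗[k] H, LinearMap.mul' k k
            (TensorProduct.map (lam ∘ₗ LinearMap.mulRight k y) (f z • Coalgebra.counit) t) =
            lam (TensorProduct.rid k H (Coalgebra.counit.lTensor H t) * y) * f z := by
          intro t
          induction t with
          | zero => simp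
          | tmul v w => simp; ring
          | add s t hs ht => simp_all [add_mul]
        simp [e]
  have e₁ : ∀ t : H ⊗[k] H,
      LinearMap.mul' k k (TensorProduct.map (lam ∘ₗ LinearMap.mulLeft k x) f t) =
        lam (x * TensorProduct.rid k H (f.lTensor H t)) := by
    intro t
    induction t with
    | zero => simp
    | tmul v w => simp [mul_comm]
    | add s t hs ht => simp_all [mul_add]
  have e₂ : ∀ t : H ⊗[k] H,
      F (Coalgebra.comul l) ((Coalgebra.comul (R := k)).rTensor H t) =
        lam (TensorProduct.rid k H
          ((f ∘ₗ LinearMap.mulRight k (𝐒 a) ∘ₗ Sinv).lTensor H t) * l) := by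
    intro t
    induction t with
    | zero => simp
    | tmul v w =>
      have := ha_mod (v * l)
      simp only [lT, LinearMap.comp_apply, Bialgebra.comul_mul, LinearEquiv.coe_coe] at this
      simp [F, this, mul_comm]
    | add s t hs ht => simp_all [add_mul]
  have := key (Coalgebra.comul l)
  rw [e₁, e₂] at this
  exact this.symm

/-- `λ(x l₂) f(l₁) = λ(x₂ l) f(S(x₁))`. -/
lemma integral_mul_lT (hlam_int : ∀ f : H →ₗ[k] k, conv f lam = f 1 • lam)
    (f : H →ₗ[k] k) (x l : H) :
    lam (x * lT f l) = lam (lT (f ∘ₗ 𝐒) x * l) := by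
  have hint : ∀ h : H, rT lam h = lam h • 1 := by
    intro h
    refine sub_eq_zero.1 ((Module.forall_dual_apply_eq_zero_iff k _).1 fun φ ↦ ?_)
    rw [map_sub, ← conv_eq_apply_rT, hlam_int]
    simp [mul_comm]
  let F (t : H ⊗[k] H) : H ⊗[k] (H ⊗[k] H) →ₗ[k] k :=
    f ∘ₗ LinearMap.mul' k H ∘ₗ TensorProduct.map (HopfAlgebra.antipode k)
      ((TensorProduct.rid k H).toLinearMap ∘ₗ lam.lTensor H ∘ₗ LinearMap.mulRight k t)
  have key : ∀ t : H ⊗[k] H,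
      LinearMap.mul' k k (TensorProduct.map f (lam ∘ₗ LinearMap.mulLeft k x) t) =
      F t ((Coalgebra.comul (R := k)).lTensor H (Coalgebra.comul x)) := by
    intro t
    induction t with
    | zero => simp [F]
    | add s t hs ht =>
      rw [map_add, map_add, hs, ht, ← LinearMap.add_apply]
      congr 1
      ext
      simp [F, mul_add]
    | tmul y z =>
      refine Eq.trans ?_ (comul_assoc_ext
        (F (y ⊗ₜ z) ∘ₗ (TensorProduct.assoc k H H H).toLinearMap)
        (LinearMap.mul' k k ∘ₗ
          TensorProduct.map (f y • Coalgebra.counit) (lam ∘ₗ LinearMap.mulRight k z))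
        (F (y ⊗ₜ z) ∘ₗ (Coalgebra.comul (R := k)).lTensor H)
        (fun u w ↦ ?_) (fun u w ↦ by simp) x)
      · have e : ∀ t : H ⊗[k] H, LinearMap.mul' k k
            (TensorProduct.map (f y • Coalgebra.counit) (lam ∘ₗ LinearMap.mulRight k z) t) =
            f y * lam (TensorProduct.lid k H (Coalgebra.counit.rTensor H t) * z) := by
          intro t
          induction t with
          | zero => simp
          | tmul v w => simp; ring
          | add s t hs ht => simp_all [add_mul, mul_add]
        simp [e]
      · have e : ∀ t : H ⊗[k] H, F (y ⊗ₜ z) (TensorProduct.assoc k H H H (t ⊗ₜ w)) =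
            f (LinearMap.mul' k H ((HopfAlgebra.antipode k).rTensor H t) * y) *
              lam (w * z) := by
          intro t
          induction t with
          | zero => simp
          | tmul u v => simp [F, mul_assoc, mul_comm]
          | add s t hs ht => simp_all [TensorProduct.add_tmul, add_mul]
        rw [LinearMap.comp_apply, LinearEquiv.coe_coe, e,
          HopfAlgebra.mul_antipode_rTensor_comul_apply, ← Algebra.smul_def]
        simp [mul_comm]
  have e₁ : ∀ t : H ⊗[k] H,
      LinearMap.mul' k k (TensorProduct.map f (lam ∘ₗ LinearMap.mulLeft k x) t) =
        lam (x * TensorProduct.lid k H (f.rTensor H t)) := by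
    intro t
    induction t with
    | zero => simp
    | tmul v w => simp
    | add s t hs ht => simp_all [mul_add]
  have e₂ : ∀ t : H ⊗[k] H,
      F (Coalgebra.comul l) ((Coalgebra.comul (R := k)).lTensor H t) =
        lam (TensorProduct.lid k H ((f ∘ₗ 𝐒).rTensor H t) * l) := by
    intro t
    induction t with
    | zero => simp
    | tmul v w =>
      have := hint (w * l)
      simp only [rT, LinearMap.comp_apply, Bialgebra.comul_mul, LinearEquiv.coe_coe] at this
      simp [F, this, mul_comm]
    | add s t hs ht => simp_all [add_mul]
  have := key (Coalgebra.comul l)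
  rw [e₁, e₂] at this
  exact this

lemma eq_zero_of_integral_mul (hlam_ne : lam ≠ 0)
    (hlam_int : ∀ f : H →ₗ[k] k, conv f lam = f 1 • lam)
    (hSinv_l : ∀ h : H, Sinv (𝐒 h) = h) (hSinv_r : ∀ h : H, 𝐒 (Sinv h) = h)
    {x : H} (hx : ∀ l, lam (x * l) = 0) : x = 0 := by
  have hlT : ∀ (g : H →ₗ[k] k) (l : H), lam (lT g x * l) = 0 := by
    intro g l
    have hg : (g ∘ₗ Sinv) ∘ₗ 𝐒 = g := by ext; simp [hSinv_l]
    rw [← hg, ← integral_mul_lT hlam_int, hx]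
  have hcounit : ∀ y : H, (∀ (g : H →ₗ[k] k) (l : H), lam (lT g y * l) = 0) →
      Coalgebra.counit (R := k) y = 0 := by
    intro y hy
    classical
    have hz : ((LinearMap.mul k H).compr₂ lam).lTensor H (Coalgebra.comul y) = 0 := by
      let b := Module.Basis.ofVectorSpace k H
      refine (TensorProduct.equivFinsuppOfBasisLeft b).injective ?_
      ext i l
      have e : ∀ t : H ⊗[k] H, (TensorProduct.equivFinsuppOfBasisLeft b
          (((LinearMap.mul k H).compr₂ lam).lTensor H t)) i l =
          lam (TensorProduct.lid k H ((b.coord i).rTensor H t) * l) := by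
        intro t
        induction t with
        | zero => simp
        | tmul x y => simp
        | add s t hs ht => simp_all [add_mul]
      rw [e]
      simpa [lT] using hy (b.coord i) l
    obtain ⟨l, hl⟩ : ∃ l, lam l ≠ 0 := by
      by_contra! h
      exact hlam_ne (LinearMap.ext h)
    have e : ∀ t : H ⊗[k] H,
        TensorProduct.lift (LinearMap.applyₗ ∘ₗ LinearMap.mulRight k l ∘ₗ Sinv)
          (((LinearMap.mul k H).compr₂ lam).lTensor H t) =
        lam (LinearMap.mul' k H (TensorProduct.comm k H H (Sinv.rTensor H t)) * l) := by
      intro t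
      induction t with
      | zero => simp
      | tmul x y => simp [mul_assoc]
      | add s t hs ht => simp_all [add_mul]
    have := e (Coalgebra.comul y)
    rw [hz, mul_rTensor_antipodeInv_comul hSinv_l hSinv_r, ← Algebra.smul_def] at this
    simpa [hl] using this.symm
  refine (Module.forall_dual_apply_eq_zero_iff k x).1 fun g ↦ ?_
  rw [← counit_lT]
  exact hcounit _ fun f l ↦ by rw [lT_lT, hlT]

end Integral

section Braiding

variable {σ : (H ⊗[k] H) →ₗ[k] k}

lemma diag_curry_flip_mulRight
    (hσ2 : ∀ h l m : H, σ (h ⊗ₜ[k] (l * m)) =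
      conv (σ ∘ₗ ((TensorProduct.mk k H H).flip m)) (σ ∘ₗ ((TensorProduct.mk k H H).flip l)) h)
    (f : H →ₗ[k] k) (θ : H →ₗ[k] H) (b : H) :
    diag ((TensorProduct.curry σ).flip ∘ₗ LinearMap.mulRight k b ∘ₗ θ ∘ₗ rT f) =
      diag ((TensorProduct.curry σ).flip ∘ₗ θ ∘ₗ
        rT (conv f ((TensorProduct.curry σ).flip b))) := by
  have e : ∀ x y : H, (TensorProduct.curry σ).flip (x * y) =
      conv ((TensorProduct.curry σ).flip y) ((TensorProduct.curry σ).flip x) :=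
    fun x y ↦ LinearMap.ext fun h ↦ hσ2 h x y
  refine (diag_comp_rT ((TensorProduct.curry σ).flip ∘ₗ LinearMap.mulRight k b ∘ₗ θ) f).trans
    (Eq.trans ?_ (diag_comp_rT ((TensorProduct.curry σ).flip ∘ₗ θ) _).symm)
  congr 1
  ext x : 1
  simp [e, conv_assoc]

/-- `f ↦ f(h₂) σ(h₃ ⊗ S(h₁))` has the left inverse `g ↦ g(h₂) σ(h₃ ⊗ h₁)`. -/
lemma diag_curry_flip_antipode_leftInverse
    (hσ2 : ∀ h l m : H, σ (h ⊗ₜ[k] (l * m)) =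
      conv (σ ∘ₗ ((TensorProduct.mk k H H).flip m)) (σ ∘ₗ ((TensorProduct.mk k H H).flip l)) h)
    (hσ3l : ∀ h : H, σ (h ⊗ₜ[k] (1 : H)) = Coalgebra.counit (R := k) h) :
    Function.LeftInverse
      (fun g : H →ₗ[k] k ↦ diag ((TensorProduct.curry σ).flip ∘ₗ rT g))
      (fun f ↦ diag ((TensorProduct.curry σ).flip ∘ₗ (HopfAlgebra.antipode k) ∘ₗ rT f)) := by
  intro f
  have hmul : ∀ x y : H, (TensorProduct.curry σ).flip (x * y) =
      conv ((TensorProduct.curry σ).flip y) ((TensorProduct.curry σ).flip x) :=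
    fun x y ↦ LinearMap.ext fun h ↦ hσ2 h x y
  have hone : (TensorProduct.curry σ).flip 1 = Coalgebra.counit :=
    LinearMap.ext fun h ↦ hσ3l h
  dsimp only
  rw [diag_comp_rT, ← LinearMap.comp_assoc, diag_comp_rT]
  ext h
  refine (comul_assoc_ext
    (TensorProduct.lift (convLeft f ∘ₗ (TensorProduct.curry σ).flip ∘ₗ LinearMap.mul' k H ∘ₗ
      (HopfAlgebra.antipode k).lTensor H))
    (TensorProduct.lift ((Coalgebra.counit (R := k)).smulRight f))
    (TensorProduct.lift (convLeft (diag (convLeft f ∘ₗ (TensorProduct.curry σ).flip ∘ₗ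
      HopfAlgebra.antipode k)) ∘ₗ (TensorProduct.curry σ).flip))
    (fun x y ↦ ?_) (fun x y ↦ ?_) h).symm.trans ?_
  · simp only [TensorProduct.lift.tmul, LinearMap.comp_apply,
      HopfAlgebra.mul_antipode_lTensor_comul_apply, Algebra.algebraMap_eq_smul_one, map_smul,
      hone, convLeft_apply, conv_counit]
    simp
  · simp only [TensorProduct.lift.tmul, LinearMap.comp_apply, convLeft_apply, conv_diag]
    simp only [diag, LinearMap.comp_apply]
    induction (Coalgebra.comul (R := k) y) with
    | zero => simp
    | tmul y z => simp [hmul, conv_assoc]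
    | add s t hs ht => simp_all [TensorProduct.tmul_add]
  · have e : ∀ t : H ⊗[k] H, TensorProduct.lift ((Coalgebra.counit (R := k)).smulRight f) t =
        f (TensorProduct.lid k H (Coalgebra.counit.rTensor H t)) := by
      intro t
      induction t with
      | zero => simp
      | tmul x y => simp
      | add s t hs ht => simp_all
    simp [e]

lemma uF_eq_diag : uF σ = diag ((TensorProduct.curry σ).flip ∘ₗ HopfAlgebra.antipode k) := by
  have : σ ∘ₗ (TensorProduct.comm k H H).toLinearMap ∘ₗ (HopfAlgebra.antipode k).rTensor H =
      TensorProduct.lift ((TensorProduct.curry σ).flip ∘ₗ HopfAlgebra.antipode k) := by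
    ext; simp
  rw [diag, ← this]
  rfl

/-- `σ(h₂ ⊗ S⁻¹(χ(h₁)) a⁻¹) = v(h)`. -/
lemma diag_curry_flip_chiMap {lam : H →ₗ[k] k} {a : H} {Sinv : H →ₗ[k] H} {α : H →ₗ[k] k}
    (hlam_ne : lam ≠ 0) (hlam_int : ∀ f : H →ₗ[k] k, conv f lam = f 1 • lam)
    (ha_mod : ∀ h : H, lT lam h = lam h • (𝐒 a))
    (hSinv_l : ∀ h : H, Sinv (𝐒 h) = h) (hSinv_r : ∀ h : H, 𝐒 (Sinv h) = h)
    (hα : ∀ h l : H, lam (l * h) = lam (chiMap Sinv α h * l))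
    (hσ4 : ∀ h l : H, ac1 σ (h ⊗ₜ[k] l) = ac2 σ (h ⊗ₜ[k] l)) :
    diag ((TensorProduct.curry σ).flip ∘ₗ LinearMap.mulRight k (𝐒 a) ∘ₗ Sinv ∘ₗ
      chiMap Sinv α) = vF σ := by
  ext h
  let R := Coalgebra.Repr.arbitrary k h
  have h₁ : ∀ l, ac1 σ (h ⊗ₜ[k] l) =
      ∑ i ∈ R.index, rT (TensorProduct.curry σ (R.right i)) l * R.left i := by
    intro l
    have e : ∀ (x y : H) (t : H ⊗[k] H), TensorProduct.rid k H (TensorProduct.map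
        (LinearMap.mul' k H ∘ₗ (TensorProduct.comm k H H).toLinearMap) σ
        (TensorProduct.tensorTensorTensorComm k H H H H ((x ⊗ₜ y) ⊗ₜ t))) =
        TensorProduct.rid k H ((TensorProduct.curry σ y).lTensor H t) * x := by
      intro x y t
      induction t with
      | zero => simp
      | tmul z w => simp
      | add s t hs ht => simp_all [TensorProduct.tmul_add, add_mul]
    simp only [ac1, LinearMap.comp_apply, TensorProduct.map_tmul, LinearEquiv.coe_coe]
    rw [← R.eq]
    simp only [TensorProduct.sum_tmul, map_sum, e]
    rfl
  have h₂ : ∀ l, ac2 σ (h ⊗ₜ[k] l) =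
      ∑ i ∈ R.index, R.right i * lT (TensorProduct.curry σ (R.left i)) l := by
    intro l
    have e : ∀ (x y : H) (t : H ⊗[k] H), TensorProduct.lid k H (TensorProduct.map
        σ (LinearMap.mul' k H)
        (TensorProduct.tensorTensorTensorComm k H H H H ((x ⊗ₜ y) ⊗ₜ t))) =
        y * TensorProduct.lid k H ((TensorProduct.curry σ x).rTensor H t) := by
      intro x y t
      induction t with
      | zero => simp
      | tmul z w => simp
      | add s t hs ht => simp_all [TensorProduct.tmul_add, mul_add]
    simp only [ac2, LinearMap.comp_apply, TensorProduct.map_tmul, LinearEquiv.coe_coe]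
    rw [← R.eq]
    simp only [TensorProduct.sum_tmul, map_sum, e]
    rfl
  have key : ∑ i ∈ R.index, rT (TensorProduct.curry σ (R.right i) ∘ₗ
        LinearMap.mulRight k (𝐒 a) ∘ₗ Sinv) (chiMap Sinv α (R.left i)) =
      ∑ i ∈ R.index, lT (TensorProduct.curry σ (R.left i) ∘ₗ 𝐒) (R.right i) := by
    refine sub_eq_zero.1 (eq_zero_of_integral_mul hlam_ne hlam_int hSinv_l hSinv_r fun l ↦ ?_)
    have := congrArg lam (hσ4 h l)
    rw [h₁, h₂, map_sum, map_sum, Finset.sum_congr rfl fun i _ ↦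
      (hα _ _).trans (integral_mul_rT hSinv_l hSinv_r ha_mod _ _ _)] at this
    simp only [integral_mul_lT hlam_int] at this
    rw [sub_mul, map_sub, Finset.sum_mul, Finset.sum_mul, map_sum, map_sum, this, sub_self]
  have := congrArg (Coalgebra.counit (R := k)) key
  simp only [map_sum, counit_rT, counit_lT] at this
  rw [diag, vF]
  simp only [LinearMap.comp_apply]
  rw [← R.eq]
  simpa using this

end Braiding

section Antipode

lemma antipodeInv_antipodeInv {Sinv : H →ₗ[k] H} (hSinv_l : ∀ h : H, Sinv (𝐒 h) = h)
    {f f' g g' : H →ₗ[k] k} (hS2 : ∀ h : H, 𝐒 (𝐒 h) = lT f (rT g h))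
    (hf : conv f' f = Coalgebra.counit) (hg : conv g g' = Coalgebra.counit) (h : H) :
    Sinv (Sinv h) = lT f' (rT g' h) := by
  have : 𝐒 (𝐒 (lT f' (rT g' h))) = h := by
    rw [hS2, ← lT_rT f', lT_lT, hf, rT_rT, hg, lT_counit, rT_counit]
  nth_rw 1 [← this]
  rw [hSinv_l, hSinv_l]

lemma chiMap_apply (Sinv : H →ₗ[k] H) (f : H →ₗ[k] k) (h : H) :
    chiMap Sinv f h = Sinv (Sinv (rT f h)) := by
  have : (TensorProduct.rid k H).toLinearMap ∘ₗ TensorProduct.map (Sinv ∘ₗ Sinv) f =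
      Sinv ∘ₗ Sinv ∘ₗ (TensorProduct.rid k H).toLinearMap ∘ₗ f.lTensor H := by
    ext; simp
  exact DFunLike.congr_fun this (Coalgebra.comul h)

lemma conv_comp_antipode_self (α : H →ₐ[k] k) :
    conv (α.toLinearMap ∘ₗ HopfAlgebra.antipode k) α.toLinearMap = Coalgebra.counit := by
  have : LinearMap.mul' k k ∘ₗ
      TensorProduct.map (α.toLinearMap ∘ₗ HopfAlgebra.antipode k) α.toLinearMap =
      α.toLinearMap ∘ₗ LinearMap.mul' k H ∘ₗ (HopfAlgebra.antipode k).rTensor H := by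
    ext; simp
  ext h
  simpa [conv] using DFunLike.congr_fun this (Coalgebra.comul h)

lemma conv_self_comp_antipode (α : H →ₐ[k] k) :
    conv α.toLinearMap (α.toLinearMap ∘ₗ HopfAlgebra.antipode k) = Coalgebra.counit := by
  have : LinearMap.mul' k k ∘ₗ
      TensorProduct.map α.toLinearMap (α.toLinearMap ∘ₗ HopfAlgebra.antipode k) =
      α.toLinearMap ∘ₗ LinearMap.mul' k H ∘ₗ (HopfAlgebra.antipode k).lTensor H := by
    ext; simp
  ext h
  simpa [conv] using DFunLike.congr_fun this (Coalgebra.comul h)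

end Antipode

/-- $u∘S = u$ iff $α_a = α^{-1}$: $σ(h_1 ⊗ S(h_2)) = σ(h_2 ⊗ S(h_1))$ for
all $h$ iff $σ(h ⊗ a^{-1}) = α(S(h))$ for all $h$. -/
theorem u_comp_antipode_eq_u_iff
    (lam : H →ₗ[k] k) (hlam_ne : lam ≠ 0)
    (hlam_int : ∀ f : H →ₗ[k] k, conv f lam = f 1 • lam)
    (a : H) (ha_ne : a ≠ 0) (ha_grp : Coalgebra.comul (R := k) a = a ⊗ₜ[k] a)
    (ha_mod : ∀ h : H, lT lam h = lam h • (𝐒 a))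
    (ha_S2 : ∀ h : H, lam (𝐒 (𝐒 h)) = lam (a * h * 𝐒 a))
    (Sinv : H →ₗ[k] H) (hSinv_l : ∀ h : H, Sinv (𝐒 h) = h)
    (hSinv_r : ∀ h : H, 𝐒 (Sinv h) = h)
    (α : H →ₐ[k] k)
    (hα : ∀ h l : H, lam (l * h) = lam ((chiMap Sinv α.toLinearMap h) * l))
    (σ : (H ⊗[k] H) →ₗ[k] k)
    (hσ1 : ∀ h l m : H, σ ((h * l) ⊗ₜ[k] m) =
      conv (σ ∘ₗ (TensorProduct.mk k H H h)) (σ ∘ₗ (TensorProduct.mk k H H l)) m)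
    (hσ2 : ∀ h l m : H, σ (h ⊗ₜ[k] (l * m)) =
      conv (σ ∘ₗ ((TensorProduct.mk k H H).flip m)) (σ ∘ₗ ((TensorProduct.mk k H H).flip l)) h)
    (hσ3l : ∀ h : H, σ (h ⊗ₜ[k] (1 : H)) = Coalgebra.counit (R := k) h)
    (hσ3r : ∀ h : H, σ ((1 : H) ⊗ₜ[k] h) = Coalgebra.counit (R := k) h)
    (hσ4 : ∀ h l : H, ac1 σ (h ⊗ₜ[k] l) = ac2 σ (h ⊗ₜ[k] l))
    (huinv_r : conv (uF σ) (uinvF σ) = Coalgebra.counit (R := k))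
    (huinv_l : conv (uinvF σ) (uF σ) = Coalgebra.counit (R := k))
    (hvinv_r : conv (vF σ) (vinvF σ) = Coalgebra.counit (R := k))
    (hvinv_l : conv (vinvF σ) (vF σ) = Coalgebra.counit (R := k))
    (hS2u : ∀ h : H, 𝐒 (𝐒 h) = sw3 (uF σ) LinearMap.id (uinvF σ) h)
    (hS2v : ∀ h : H, 𝐒 (𝐒 h) = sw3 (vinvF σ) LinearMap.id (vF σ) h) :
    (∀ h : H, vF σ h = uF σ h) ↔ (∀ h : H, σ (h ⊗ₜ[k] (𝐒 a)) = α (𝐒 h)) := by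
  have hu := antipodeInv_antipodeInv hSinv_l (fun h ↦ (hS2u h).trans (sw3_id _ _ h))
    huinv_l huinv_l
  have hv := antipodeInv_antipodeInv hSinv_l (fun h ↦ (hS2v h).trans (sw3_id _ _ h))
    hvinv_r hvinv_r
  have hχ : Sinv ∘ₗ chiMap Sinv α.toLinearMap = ((HopfAlgebra.antipode k) ∘ₗ
      rT (conv (uF σ) (conv (vinvF σ) α.toLinearMap))) ∘ₗ lT (conv (vF σ) (uinvF σ)) := by
    ext h
    simp only [LinearMap.comp_apply]
    rw [← hSinv_r (Sinv _), hu, chiMap_apply, hv, rT_rT, ← lT_rT (vF σ), lT_lT, rT_rT, lT_rT]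
  have hdiag := diag_curry_flip_chiMap hlam_ne hlam_int ha_mod hSinv_l hSinv_r hα hσ4
  rw [hχ, ← LinearMap.comp_assoc, ← LinearMap.comp_assoc, diag_comp_lT, LinearMap.comp_assoc,
    diag_curry_flip_mulRight hσ2] at hdiag
  set αa := (TensorProduct.curry σ).flip (𝐒 a) with hαa
  replace hdiag := congrArg (fun f ↦ conv (uF σ) (conv (vinvF σ) f)) hdiag
  have hgrp : conv (uF σ) (conv (vinvF σ) (conv α.toLinearMap αa)) = Coalgebra.counit := by
    refine (diag_curry_flip_antipode_leftInverse hσ2 hσ3l).injective ?_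
    have hc : rT (Coalgebra.counit (R := k) (A := H)) = LinearMap.id :=
      LinearMap.ext rT_counit
    simp only [hc, LinearMap.comp_id, ← uF_eq_diag, ← conv_assoc]
    simp only [hvinv_l, conv_counit] at hdiag
    rw [← conv_assoc, ← conv_assoc, conv_assoc (uF σ), ← conv_assoc (vinvF σ), hvinv_l,
      counit_conv, huinv_r, counit_conv] at hdiag
    simpa only [conv_assoc] using hdiag
  have hαS_l := conv_comp_antipode_self α
  have hαS_r := conv_self_comp_antipode α
  have hiff : (∀ h : H, σ (h ⊗ₜ[k] (𝐒 a)) = α (𝐒 h)) ↔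
      conv α.toLinearMap αa = Coalgebra.counit := by
    refine ⟨fun h ↦ ?_, fun h ↦ ?_⟩
    · have : αa = α.toLinearMap ∘ₗ HopfAlgebra.antipode k := LinearMap.ext h
      rw [this, hαS_r]
    · have := congrArg (conv (α.toLinearMap ∘ₗ HopfAlgebra.antipode k)) h
      rw [← conv_assoc, hαS_l, counit_conv, conv_counit] at this
      exact fun h ↦ DFunLike.congr_fun this h
  rw [hiff, ← LinearMap.ext_iff]
  refine ⟨fun h ↦ ?_, fun h ↦ ?_⟩
  · rwa [← h, ← conv_assoc, hvinv_r, counit_conv] at hgrp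
  · rw [h, conv_counit] at hgrp
    rw [← counit_conv (vF σ), ← hgrp, conv_assoc, hvinv_l, conv_counit]
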